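/- arXiv:2103.03613 — 6 statements merged into one kernel-verified Lean document; each statement's English description precedes it below -/
import Mathlib

section
/- Let V be an n×m real matrix such that 0 lies in the interior of C_V(V). Then for every x ∈ ℝⁿ, ψ_V(x) = sup{hᵀx : h ∈ ℝⁿ, hᵀV ≤ 1ᵀ componentwise}, and this supremum is attained and finite (linear-programming strong duality between the primal and dual representations of ψ_V). -/
open Matrix Pointwise

/-- The V-representation polyhedron `C_V(V)`: the convex hull of the columns of `V`,
`{x : x = Vp, p ≥ 0, 1ᵀp = 1}`. -/
def polyV {n m : ℕ} (V : Matrix (Fin n) (Fin m) ℝ) : Set (Fin n → ℝ) :=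
  {x | ∃ p : Fin m → ℝ, (∀ i, 0 ≤ p i) ∧ (∑ i, p i) = 1 ∧ x = V.mulVec p}

/-- The gauge function `ψ_V(x) = inf {1ᵀp : x = Vp, p ≥ 0}`. -/
noncomputable def psiV {n m : ℕ} (V : Matrix (Fin n) (Fin m) ℝ) (x : Fin n → ℝ) : ℝ :=
  sInf {r : ℝ | ∃ p : Fin m → ℝ, (∀ i, 0 ≤ p i) ∧ x = V.mulVec p ∧ (∑ i, p i) = r}

/-- The subdifferential `∂ψ_V(x) = {h : ψ_V(y) − ψ_V(x) ≥ hᵀ(y − x) for all y}`. -/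
def subdiffV {n m : ℕ} (V : Matrix (Fin n) (Fin m) ℝ) (x : Fin n → ℝ) : Set (Fin n → ℝ) :=
  {h | ∀ y : Fin n → ℝ, psiV V y - psiV V x ≥ h ⬝ᵥ (y - x)}

/-- The values `1ᵀp` of the feasible points of the primal program defining `psiV V x`. -/
def primalValues {n m : ℕ} (V : Matrix (Fin n) (Fin m) ℝ) (x : Fin n → ℝ) : Set ℝ :=
  {r : ℝ | ∃ p : Fin m → ℝ, (∀ i, 0 ≤ p i) ∧ x = V.mulVec p ∧ (∑ i, p i) = r}

section PsiV

variable {n m : ℕ} {V : Matrix (Fin n) (Fin m) ℝ}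

lemma nonneg_of_mem_primalValues {x : Fin n → ℝ} {r : ℝ} (hr : r ∈ primalValues V x) :
    0 ≤ r := by
  obtain ⟨p, hp, -, rfl⟩ := hr
  exact Finset.sum_nonneg fun i _ => hp i

lemma bddBelow_primalValues (x : Fin n → ℝ) : BddBelow (primalValues V x) :=
  ⟨0, fun _ => nonneg_of_mem_primalValues⟩

lemma psiV_nonneg (x : Fin n → ℝ) : 0 ≤ psiV V x :=
  Real.sInf_nonneg fun _ => nonneg_of_mem_primalValues

lemma psiV_le_sum {p : Fin m → ℝ} (hp : ∀ i, 0 ≤ p i) : psiV V (V *ᵥ p) ≤ ∑ i, p i :=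
  csInf_le (bddBelow_primalValues _) ⟨p, hp, rfl, rfl⟩

lemma psiV_zero : psiV V 0 = 0 :=
  le_antisymm (by simpa using psiV_le_sum (V := V) (p := 0) fun _ => le_rfl) (psiV_nonneg 0)

lemma psiV_col_le_one (j : Fin m) : psiV V (Vᵀ j) ≤ 1 := by
  have h := psiV_le_sum (V := V) (p := Pi.single j 1) fun i => by
    by_cases hij : i = j
    · subst hij; simp
    · simp [hij]
  rwa [Matrix.mulVec_single_one, Finset.sum_pi_single', if_pos (Finset.mem_univ j)] at h

lemma primalValues_nonempty (hV : (0 : Fin n → ℝ) ∈ interior (polyV V)) (x : Fin n → ℝ) :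
    (primalValues V x).Nonempty := by
  have habs : Absorbent ℝ (polyV V) := absorbent_nhds_zero (mem_interior_iff_mem_nhds.mp hV)
  obtain ⟨r, hr, hsub⟩ := (habs x).exists_pos
  obtain ⟨y, ⟨p, hp, -, rfl⟩, hy⟩ :=
    Set.singleton_subset_iff.mp (hsub r (by rw [Real.norm_of_nonneg hr.le]))
  exact ⟨_, r • p, fun i => mul_nonneg hr.le (hp i), by rw [Matrix.mulVec_smul]; exact hy.symm, rfl⟩

lemma psiV_smul {c : ℝ} (hc : 0 < c) (x : Fin n → ℝ) : psiV V (c • x) = c * psiV V x := by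
  have h : primalValues V (c • x) = c • primalValues V x := by
    ext r
    rw [Set.mem_smul_set_iff_inv_smul_mem₀ hc.ne']
    constructor
    · rintro ⟨p, hp, hx, rfl⟩
      exact ⟨c⁻¹ • p, fun i => mul_nonneg (inv_nonneg.mpr hc.le) (hp i),
        by rw [Matrix.mulVec_smul, ← hx, inv_smul_smul₀ hc.ne'], by simp [Finset.mul_sum]⟩
    · rintro ⟨p, hp, rfl, hr⟩
      refine ⟨c • p, fun i => mul_nonneg hc.le (hp i), by rw [Matrix.mulVec_smul], ?_⟩
      rw [eq_inv_smul_iff₀ hc.ne'] at hr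
      rw [← hr]
      simp [Finset.mul_sum]
  change sInf (primalValues V (c • x)) = c * sInf (primalValues V x)
  rw [h, Real.sInf_smul_of_nonneg hc.le, smul_eq_mul]

lemma psiV_add_le (hV : (0 : Fin n → ℝ) ∈ interior (polyV V)) (x y : Fin n → ℝ) :
    psiV V (x + y) ≤ psiV V x + psiV V y := by
  have hx := primalValues_nonempty hV x
  have hy := primalValues_nonempty hV y
  change psiV V (x + y) ≤ sInf (primalValues V x) + sInf (primalValues V y)
  rw [← csInf_add hx (bddBelow_primalValues x) hy (bddBelow_primalValues y)]
  refine le_csInf (hx.add hy) ?_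
  rintro _ ⟨_, ⟨p, hp, rfl, rfl⟩, _, ⟨q, hq, rfl, rfl⟩, rfl⟩
  simpa [Matrix.mulVec_add, Finset.sum_add_distrib] using
    psiV_le_sum (V := V) (p := p + q) fun i => add_nonneg (hp i) (hq i)

/-- Weak duality. -/
lemma dotProduct_le_psiV (hV : (0 : Fin n → ℝ) ∈ interior (polyV V)) (x : Fin n → ℝ)
    {h : Fin n → ℝ} (hh : ∀ j, h ⬝ᵥ Vᵀ j ≤ 1) : h ⬝ᵥ x ≤ psiV V x := by
  refine le_csInf (primalValues_nonempty hV x) ?_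
  rintro _ ⟨p, hp, rfl, rfl⟩
  rw [Matrix.dotProduct_mulVec]
  exact Finset.sum_le_sum fun j _ => mul_le_of_le_one_left (hp j) (hh j)

/-- Hahn–Banach: the sublinear function `psiV V` is supported at `x` by a linear functional. -/
lemma exists_dotProduct_le_psiV (hV : (0 : Fin n → ℝ) ∈ interior (polyV V)) (x : Fin n → ℝ) :
    ∃ h : Fin n → ℝ, h ⬝ᵥ x = psiV V x ∧ ∀ y, h ⬝ᵥ y ≤ psiV V y := by
  rcases eq_or_ne x 0 with rfl | hx
  · exact ⟨0, by simp [psiV_zero], fun y => by simpa using psiV_nonneg y⟩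
  obtain ⟨g, hg, hgle⟩ := exists_extension_of_le_sublinear
    (LinearPMap.mkSpanSingleton x (psiV V x) hx) (psiV V) (fun c hc y => psiV_smul hc y)
    (psiV_add_le hV) <| by
      rintro ⟨y, hy⟩
      obtain ⟨t, rfl⟩ := Submodule.mem_span_singleton.mp hy
      rw [LinearPMap.mkSpanSingleton'_apply, RingHom.id_apply, smul_eq_mul]
      rcases le_or_gt t 0 with ht | ht
      · exact (mul_nonpos_of_nonpos_of_nonneg ht (psiV_nonneg x)).trans (psiV_nonneg _)
      · exact (psiV_smul ht x).ge
  obtain ⟨h, rfl⟩ := (dotProductEquiv ℝ (Fin n)).surjective g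
  exact ⟨h, (hg ⟨x, Submodule.mem_span_singleton_self x⟩).trans
    (LinearPMap.mkSpanSingleton_apply ℝ ℝ hx _), hgle⟩

end PsiV

theorem stmt4 {n m : ℕ} (V : Matrix (Fin n) (Fin m) ℝ)
    (hV : (0 : Fin n → ℝ) ∈ interior (polyV V)) (x : Fin n → ℝ) :
    psiV V x = sSup {c : ℝ | ∃ h : Fin n → ℝ, (∀ j, h ⬝ᵥ Vᵀ j ≤ 1) ∧ c = h ⬝ᵥ x} ∧
    ∃ h : Fin n → ℝ, (∀ j, h ⬝ᵥ Vᵀ j ≤ 1) ∧ h ⬝ᵥ x = psiV V x ∧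
      ∀ h' : Fin n → ℝ, (∀ j, h' ⬝ᵥ Vᵀ j ≤ 1) → h' ⬝ᵥ x ≤ psiV V x := by
  obtain ⟨h, hhx, hle⟩ := exists_dotProduct_le_psiV hV x
  have hfeas : ∀ j, h ⬝ᵥ Vᵀ j ≤ 1 := fun j => (hle _).trans (psiV_col_le_one j)
  have hgreatest : IsGreatest {c : ℝ | ∃ h : Fin n → ℝ, (∀ j, h ⬝ᵥ Vᵀ j ≤ 1) ∧ c = h ⬝ᵥ x}
      (psiV V x) := by
    refine ⟨⟨h, hfeas, hhx.symm⟩, ?_⟩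
    rintro _ ⟨h', hh', rfl⟩
    exact dotProduct_le_psiV hV x hh'
  exact ⟨hgreatest.csSup_eq.symm, h, hfeas, hhx, fun _ => dotProduct_le_psiV hV x⟩
end

section
/- (Contraction in V-representation) Let V be an n×m real matrix satisfying (A2) (0 in the interior of C_V(V)) and let A be an n×n real matrix. Then the geometric contraction condition — for every x ∈ C_V(V), Ax lies in the interior of the tangent cone to C_V(V) at x, i.e. there exists λ > 0 with x + λAx ∈ interior C_V(V) — holds if and only if there exist an m×m real matrix M and a scalar η > 0 such that 1ᵀM = −η1ᵀ, AV = VM, and all off-diagonal entries of M are nonnegative (M is Metzler). -/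
open Matrix Pointwise

theorem polyV_eq_image_stdSimplex {n m : ℕ} (V : Matrix (Fin n) (Fin m) ℝ) :
    polyV V = V.mulVecLin '' stdSimplex ℝ (Fin m) := by
  ext x
  constructor
  · rintro ⟨p, hp, hs, rfl⟩
    exact ⟨p, ⟨hp, hs⟩, rfl⟩
  · rintro ⟨p, ⟨hp, hs⟩, rfl⟩
    exact ⟨p, hp, hs, rfl⟩

theorem convex_polyV {n m : ℕ} (V : Matrix (Fin n) (Fin m) ℝ) : Convex ℝ (polyV V) := by
  rw [polyV_eq_image_stdSimplex]
  exact (convex_stdSimplex ℝ (Fin m)).linear_image V.mulVecLin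

theorem col_mem_polyV {n m : ℕ} (V : Matrix (Fin n) (Fin m) ℝ) (j : Fin m) :
    V.mulVec (Pi.single j 1) ∈ polyV V :=
  ⟨Pi.single j 1, fun i => by by_cases h : i = j <;> simp [h], by simp, rfl⟩

/-- An interior point of `polyV V` is a nonnegative combination of the columns of `V` with total
weight strictly below one. -/
theorem exists_sum_lt_one_of_mem_interior {n m : ℕ} {V : Matrix (Fin n) (Fin m) ℝ}
    {y : Fin n → ℝ} (hy : y ∈ interior (polyV V)) :
    ∃ q : Fin m → ℝ, (∀ i, 0 ≤ q i) ∧ (∑ i, q i) < 1 ∧ y = V.mulVec q := by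
  have hc : Filter.Tendsto (fun t : ℝ => t • y) (nhdsWithin 1 (Set.Ioi 1)) (nhds y) := by
    have : Continuous (fun t : ℝ => t • y) := by fun_prop
    simpa using (this.tendsto 1).mono_left nhdsWithin_le_nhds
  obtain ⟨t, ⟨p, hp, hs, hty⟩, ht⟩ :=
    ((hc.eventually (mem_interior_iff_mem_nhds.mp hy)).and self_mem_nhdsWithin).exists
  have ht1 : (1 : ℝ) < t := ht
  have ht0 : 0 < t := by linarith
  refine ⟨t⁻¹ • p, fun i => mul_nonneg (by positivity) (hp i), ?_, ?_⟩
  · simp only [Pi.smul_apply, smul_eq_mul, ← Finset.mul_sum, hs, mul_one]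
    exact inv_lt_one_of_one_lt₀ ht1
  · rw [Matrix.mulVec_smul, ← hty, smul_smul, inv_mul_cancel₀ ht0.ne', one_smul]

/-- When `0` is interior to `polyV V`, nonnegative combinations of the columns of `V` with total
weight in `(0, 1)` are interior points. -/
theorem mulVec_mem_interior_polyV {n m : ℕ} {V : Matrix (Fin n) (Fin m) ℝ}
    (hV : (0 : Fin n → ℝ) ∈ interior (polyV V)) {q : Fin m → ℝ} (hq : ∀ i, 0 ≤ q i)
    (hpos : 0 < ∑ i, q i) (hlt : ∑ i, q i < 1) : V.mulVec q ∈ interior (polyV V) := by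
  set r := ∑ i, q i with hr
  have hz : V.mulVec (r⁻¹ • q) ∈ polyV V := by
    refine ⟨r⁻¹ • q, fun i => mul_nonneg (by positivity) (hq i), ?_, rfl⟩
    simp only [Pi.smul_apply, smul_eq_mul, ← Finset.mul_sum, ← hr]
    exact inv_mul_cancel₀ hpos.ne'
  have h := (convex_polyV V).combo_interior_self_mem_interior hV hz
    (sub_pos.mpr hlt) hpos.le (by ring)
  rwa [smul_zero, zero_add, Matrix.mulVec_smul, smul_smul, mul_inv_cancel₀ hpos.ne',
    one_smul] at h

/-- If `A` points strictly inwards at the `j`-th column of `V`, then `A` applied to that column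
has a representation with nonnegative weights off `j` and negative total weight. -/
theorem exists_column_of_mem_interior {n m : ℕ} {V : Matrix (Fin n) (Fin m) ℝ}
    {A : Matrix (Fin n) (Fin n) ℝ} {j : Fin m} {l : ℝ} (hl : 0 < l)
    (h : V.mulVec (Pi.single j 1) + l • A.mulVec (V.mulVec (Pi.single j 1)) ∈
      interior (polyV V)) :
    ∃ c : Fin m → ℝ, (∀ i, i ≠ j → 0 ≤ c i) ∧ (∑ i, c i) < 0 ∧
      A.mulVec (V.mulVec (Pi.single j 1)) = V.mulVec c := by
  obtain ⟨q, hq, hs, hy⟩ := exists_sum_lt_one_of_mem_interior h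
  refine ⟨l⁻¹ • (q - Pi.single j 1), fun i hi => ?_, ?_, ?_⟩
  · simpa [hi] using mul_nonneg (inv_nonneg.mpr hl.le) (hq i)
  · simp only [Pi.smul_apply, Pi.sub_apply, smul_eq_mul, ← Finset.mul_sum,
      Finset.sum_sub_distrib, Finset.sum_pi_single', Finset.mem_univ, if_true]
    exact mul_neg_of_pos_of_neg (inv_pos.mpr hl) (by simpa using hs)
  · rw [Matrix.mulVec_smul, Matrix.mulVec_sub, ← hy, add_sub_cancel_left, smul_smul,
      inv_mul_cancel₀ hl.ne', one_smul]

theorem stmt8 {n m : ℕ} (V : Matrix (Fin n) (Fin m) ℝ)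
    (hV : (0 : Fin n → ℝ) ∈ interior (polyV V)) (A : Matrix (Fin n) (Fin n) ℝ) :
    (∀ x ∈ polyV V, ∃ lam : ℝ, 0 < lam ∧ x + lam • A.mulVec x ∈ interior (polyV V)) ↔
    ∃ (M : Matrix (Fin m) (Fin m) ℝ) (η : ℝ), 0 < η ∧
      (∀ j, ∑ i, M i j = -η) ∧ A * V = V * M ∧ (∀ i j, i ≠ j → 0 ≤ M i j) := by
  constructor
  · intro h
    have hcol : ∀ j : Fin m, ∃ c : Fin m → ℝ, (∀ i, i ≠ j → 0 ≤ c i) ∧ (∑ i, c i) < 0 ∧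
        A.mulVec (V.mulVec (Pi.single j 1)) = V.mulVec c := fun j => by
      obtain ⟨l, hl, hmem⟩ := h _ (col_mem_polyV V j)
      exact exists_column_of_mem_interior hl hmem
    choose c hc hneg hAc using hcol
    obtain ⟨q, hq, hq1, hq0⟩ := interior_subset hV
    have : Nonempty (Fin m) := by
      by_contra hne
      rw [not_nonempty_iff] at hne
      simp at hq1
    obtain ⟨k, hk⟩ := Finite.exists_max fun j => ∑ i, c j i
    -- A convex representation of `0` pads every column sum up to the largest one.
    refine ⟨Matrix.of fun i j => c j i + (∑ i, c k i - ∑ i, c j i) * q i, -∑ i, c k i,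
      neg_pos.mpr (hneg k), fun j => ?_, ?_, fun i j hij => ?_⟩
    · simp only [Matrix.of_apply, Finset.sum_add_distrib, ← Finset.mul_sum, hq1]
      ring
    · refine Matrix.ext_of_mulVec_single fun j => ?_
      have hMj : (Matrix.of fun i j => c j i + (∑ i, c k i - ∑ i, c j i) * q i).mulVec
          (Pi.single j 1) = c j + (∑ i, c k i - ∑ i, c j i) • q := by
        ext i
        simp
      rw [← Matrix.mulVec_mulVec, ← Matrix.mulVec_mulVec, hAc, hMj, Matrix.mulVec_add,
        Matrix.mulVec_smul, ← hq0, smul_zero, add_zero]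
    · exact add_nonneg (hc j i hij) (mul_nonneg (sub_nonneg.mpr (hk j)) (hq i))
  · rintro ⟨M, η, hη, hsum, hAV, hM⟩ x ⟨p, hp, hp1, rfl⟩
    set S := 1 + η + ∑ j, |M j j| with hS
    have hS0 : 0 ≤ ∑ j, |M j j| := Finset.sum_nonneg fun j _ => abs_nonneg _
    have hSpos : 0 < S := by linarith
    refine ⟨S⁻¹, inv_pos.mpr hSpos, ?_⟩
    have hx : V.mulVec p + S⁻¹ • A.mulVec (V.mulVec p) =
        V.mulVec (p + S⁻¹ • M.mulVec p) := by
      rw [Matrix.mulVec_mulVec, hAV, Matrix.mulVec_add, Matrix.mulVec_smul,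
        Matrix.mulVec_mulVec]
    have hMp : ∑ i, M.mulVec p i = -η := by
      simp only [Matrix.mulVec, dotProduct]
      rw [Finset.sum_comm]
      simp only [← Finset.sum_mul, hsum, ← Finset.mul_sum, hp1, mul_one]
    have hqsum : ∑ i, (p + S⁻¹ • M.mulVec p) i = 1 - S⁻¹ * η := by
      simp only [Pi.add_apply, Pi.smul_apply, smul_eq_mul, Finset.sum_add_distrib,
        ← Finset.mul_sum, hMp, hp1]
      ring
    have hSη : S⁻¹ * η < 1 := by
      rw [inv_mul_lt_iff₀ hSpos]
      linarith
    have hSη0 : 0 < S⁻¹ * η := by positivity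
    rw [hx]
    refine mulVec_mem_interior_polyV hV (fun i => ?_) (by linarith) (by linarith)
    have hrow : M i i * p i ≤ M.mulVec p i := by
      simp only [Matrix.mulVec, dotProduct]
      rw [← Finset.add_sum_erase _ _ (Finset.mem_univ i)]
      exact le_add_of_nonneg_right <| Finset.sum_nonneg fun j hj =>
        mul_nonneg (hM i j (Finset.ne_of_mem_erase hj).symm) (hp j)
    have hdiag : -S ≤ M i i := by
      have h1 := Finset.single_le_sum (f := fun j => |M j j|) (fun j _ => abs_nonneg _)
        (Finset.mem_univ i)
      have h2 := neg_abs_le (M i i)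
      linarith
    have hlow : -S * p i ≤ M.mulVec p i :=
      (mul_le_mul_of_nonneg_right hdiag (hp i)).trans hrow
    have hscaled := mul_le_mul_of_nonneg_left hlow (inv_nonneg.mpr hSpos.le)
    have hcancel : S⁻¹ * (-S * p i) = -p i := by
      field_simp
    simp only [Pi.add_apply, Pi.smul_apply, smul_eq_mul]
    linarith
end

section
/- Let V be an n×m real matrix satisfying (A2), let A be an n×n real matrix and η a real scalar. Suppose there exists an m×m matrix M̂ with 1ᵀM̂ ≤ −η1ᵀ componentwise, AV = VM̂, and all off-diagonal entries of M̂ nonnegative. Then there exists an m×m matrix M with the exact equality 1ᵀM = −η1ᵀ, AV = VM, and all off-diagonal entries of M nonnegative. -/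
open Matrix Pointwise

theorem stmt10 {n m : ℕ} (V : Matrix (Fin n) (Fin m) ℝ)
    (hV : (0 : Fin n → ℝ) ∈ interior (polyV V)) (A : Matrix (Fin n) (Fin n) ℝ) (η : ℝ)
    (hM : ∃ Mh : Matrix (Fin m) (Fin m) ℝ,
      (∀ j, ∑ i, Mh i j ≤ -η) ∧ A * V = V * Mh ∧ (∀ i j, i ≠ j → 0 ≤ Mh i j)) :
    ∃ M : Matrix (Fin m) (Fin m) ℝ,
      (∀ j, ∑ i, M i j = -η) ∧ A * V = V * M ∧ (∀ i j, i ≠ j → 0 ≤ M i j) := by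
  obtain ⟨Mh, hsum, hAV, hoff⟩ := hM
  obtain ⟨p, hp, hp1, hVp⟩ := interior_subset hV
  refine ⟨Mh + vecMulVec p (fun j => -η - ∑ i, Mh i j), fun j => ?_, ?_, fun i j hij => ?_⟩
  · simp only [Matrix.add_apply, vecMulVec_apply, Finset.sum_add_distrib, ← Finset.sum_mul, hp1]
    ring
  · rw [Matrix.mul_add, mul_vecMulVec, ← hVp, zero_vecMulVec, add_zero, hAV]
  · exact add_nonneg (hoff i j hij) (mul_nonneg (hp i) (sub_nonneg.2 (hsum j)))
end

section
/- (Forward direction of the Lyapunov stability equivalence) Let V be an n×m real matrix satisfying (A2), A an n×n real matrix, and η a real scalar. If there exists an m×m matrix M with 1ᵀM = −η1ᵀ, AV = VM, and nonnegative off-diagonal entries, then for every x ∈ ℝⁿ, every h ∈ ℝⁿ with hᵀx = ψ_V(x) and hᵀV ≤ 1ᵀ componentwise satisfies hᵀAx ≤ −η ψ_V(x). -/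
open Matrix Pointwise

/-- Under (A2), every vector is a nonnegative combination of the columns of `V`. -/
theorem exists_nonneg_mulVec_eq {n m : ℕ} (V : Matrix (Fin n) (Fin m) ℝ)
    (hV : (0 : Fin n → ℝ) ∈ interior (polyV V)) (x : Fin n → ℝ) :
    ∃ p : Fin m → ℝ, (∀ i, 0 ≤ p i) ∧ x = V.mulVec p := by
  have htendsto : Filter.Tendsto (fun t : ℝ => t • x) (nhdsWithin 0 (Set.Ioi 0)) (nhds 0) := by
    have hcont : Continuous fun t : ℝ => t • x := by fun_prop
    simpa using (hcont.tendsto 0).mono_left nhdsWithin_le_nhds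
  obtain ⟨t, ⟨p, hp, -, hpx⟩, ht⟩ :=
    ((htendsto.eventually (mem_interior_iff_mem_nhds.mp hV)).and self_mem_nhdsWithin).exists
  have ht : 0 < t := ht
  refine ⟨t⁻¹ • p, fun i => mul_nonneg (inv_nonneg.mpr ht.le) (hp i), ?_⟩
  rw [Matrix.mulVec_smul, ← hpx, inv_smul_smul₀ (ne_of_gt ht)]

/-- A Metzler matrix with column sums `-η`, tested against a row vector `u ≤ 1` and a vector
`p ≥ 0`; `K` bounds the diagonal entries below by `-K`. -/
theorem dotProduct_metzler_mulVec_le {m : ℕ} (M : Matrix (Fin m) (Fin m) ℝ) (η K : ℝ)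
    (hrate : ∀ j, ∑ i, M i j = -η) (hmetzler : ∀ i j, i ≠ j → 0 ≤ M i j)
    (hK : ∀ i, -K ≤ M i i) (u p : Fin m → ℝ) (hu : ∀ i, u i ≤ 1) (hp : ∀ i, 0 ≤ p i) :
    u ⬝ᵥ M.mulVec p ≤ -η * ∑ i, p i + K * (∑ i, p i - u ⬝ᵥ p) := by
  have hcol (j : Fin m) : ∑ i, u i * M i j ≤ -η + K * (1 - u j) := by
    have hdiag : (1 - u j) * M j j ≤ ∑ i, (1 - u i) * M i j := by
      rw [← Finset.add_sum_erase _ _ (Finset.mem_univ j), le_add_iff_nonneg_right]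
      exact Finset.sum_nonneg fun i hi =>
        mul_nonneg (sub_nonneg.mpr (hu i)) (hmetzler i j (Finset.ne_of_mem_erase hi))
    simp only [sub_mul, one_mul, Finset.sum_sub_distrib, hrate] at hdiag
    nlinarith [mul_le_mul_of_nonneg_left (hK j) (sub_nonneg.mpr (hu j))]
  calc u ⬝ᵥ M.mulVec p = ∑ j, (∑ i, u i * M i j) * p j := by
        rw [Matrix.dotProduct_mulVec]; rfl
    _ ≤ ∑ j, (-η + K * (1 - u j)) * p j :=
        Finset.sum_le_sum fun j _ => mul_le_mul_of_nonneg_right (hcol j) (hp j)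
    _ = -η * ∑ i, p i + K * (∑ i, p i - u ⬝ᵥ p) := by
        simp only [dotProduct]
        rw [← Finset.sum_sub_distrib, Finset.mul_sum, Finset.mul_sum, ← Finset.sum_add_distrib]
        exact Finset.sum_congr rfl fun j _ => by ring

theorem stmt12 {n m : ℕ} (V : Matrix (Fin n) (Fin m) ℝ)
    (hV : (0 : Fin n → ℝ) ∈ interior (polyV V)) (A : Matrix (Fin n) (Fin n) ℝ) (η : ℝ)
    (M : Matrix (Fin m) (Fin m) ℝ)
    (hrate : ∀ j, ∑ i, M i j = -η) (heq : A * V = V * M)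
    (hmetzler : ∀ i j, i ≠ j → 0 ≤ M i j) :
    ∀ (x h : Fin n → ℝ), h ⬝ᵥ x = psiV V x → (∀ j, h ⬝ᵥ Vᵀ j ≤ 1) →
      h ⬝ᵥ A.mulVec x ≤ -η * psiV V x := by
  intro x h hx hle
  set K := ∑ i, |M i i|
  have hK0 : 0 ≤ K := Finset.sum_nonneg fun i _ => abs_nonneg _
  have hK (i : Fin m) : -K ≤ M i i :=
    (neg_le_neg (Finset.single_le_sum (f := fun i => |M i i|)
      (fun i _ => abs_nonneg _) (Finset.mem_univ i))).trans (neg_abs_le _)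
  have hu (j : Fin m) : (h ᵥ* V) j ≤ 1 := hle j
  have hC : 0 < K + |η| + 1 := by positivity
  suffices hbound : (h ⬝ᵥ A.mulVec x + η * psiV V x) / (K + |η| + 1) + psiV V x ≤ psiV V x by
    rw [add_le_iff_nonpos_left, div_le_iff₀ hC] at hbound
    linarith
  obtain ⟨q, hq, hqx⟩ := exists_nonneg_mulVec_eq V hV x
  refine le_csInf ⟨_, q, hq, hqx, rfl⟩ ?_
  rintro r ⟨p, hp, hpx, rfl⟩
  have hup : (h ᵥ* V) ⬝ᵥ p = psiV V x := by rw [← Matrix.dotProduct_mulVec, ← hpx, hx]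
  have hAx : h ⬝ᵥ A.mulVec x = (h ᵥ* V) ⬝ᵥ M.mulVec p := by
    rw [← Matrix.dotProduct_mulVec, hpx, Matrix.mulVec_mulVec, heq, Matrix.mulVec_mulVec]
  have hmain := dotProduct_metzler_mulVec_le M η K hrate hmetzler hK _ p hu hp
  have hgap : psiV V x ≤ ∑ i, p i := by
    rw [← hup]
    exact Finset.sum_le_sum fun i _ => mul_le_of_le_one_left (hp i) (hu i)
  rw [← hAx, hup] at hmain
  rw [← le_sub_iff_add_le, div_le_iff₀ hC]
  nlinarith [mul_le_mul_of_nonneg_right (neg_abs_le η) (sub_nonneg.mpr hgap),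
    mul_le_mul_of_nonneg_right (neg_le_abs η) (sub_nonneg.mpr hgap)]
end

section
/- (Existence of a finite contraction rate) Let V be an n×m real matrix satisfying (A2) and let A be an n×n real matrix. Then there exist a finite real scalar η (not necessarily positive) and an m×m matrix M such that 1ᵀM = −η1ᵀ, AV = VM, and all off-diagonal entries of M are nonnegative. -/
open Matrix Pointwise

theorem stmt14 {n m : ℕ} (V : Matrix (Fin n) (Fin m) ℝ)
    (hV : (0 : Fin n → ℝ) ∈ interior (polyV V)) (A : Matrix (Fin n) (Fin n) ℝ) :
    ∃ (η : ℝ) (M : Matrix (Fin m) (Fin m) ℝ),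
      (∀ j, ∑ i, M i j = -η) ∧ A * V = V * M ∧ (∀ i j, i ≠ j → 0 ≤ M i j) := by
  have hscale : ∀ᶠ t : ℝ in nhdsWithin 0 (Set.Ioi 0),
      ∀ j, t • (A *ᵥ V.col j) ∈ polyV V := by
    refine Filter.eventually_all.2 fun j => ?_
    have hcont : Filter.Tendsto (fun t : ℝ => t • (A *ᵥ V.col j)) (nhds 0) (nhds 0) :=
      Continuous.tendsto' (by fun_prop) _ _ (zero_smul _ _)
    exact nhdsWithin_le_nhds (hcont (mem_interior_iff_mem_nhds.1 hV))
  obtain ⟨t, hmem, ht⟩ := (hscale.and self_mem_nhdsWithin).exists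
  choose p hp_nonneg hp_sum hp_eq using hmem
  refine ⟨-t⁻¹, Matrix.of fun i j => t⁻¹ * p j i, fun j => ?_, ?_, fun i j _ => ?_⟩
  · simp [← Finset.mul_sum, hp_sum]
  · ext i j
    have h := congrFun (hp_eq j) i
    simp only [Pi.smul_apply, smul_eq_mul, mulVec, dotProduct, Matrix.col_apply] at h
    simp only [Matrix.mul_apply, Matrix.of_apply, mul_left_comm _ t⁻¹, ← Finset.mul_sum, ← h]
    rw [inv_mul_cancel_left₀ ht.ne']
  · exact mul_nonneg (inv_nonneg.2 ht.le) (hp_nonneg j i)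
end

section
/- (Monotonicity in the contraction rate) Let V be an n×m real matrix satisfying (A2) and let A be an n×n real matrix. If there exist η* ∈ ℝ and an m×m matrix M* with 1ᵀM* = −η*1ᵀ, AV = VM*, and nonnegative off-diagonal entries, then for every η < η* there exists an m×m matrix M with 1ᵀM = −η1ᵀ, AV = VM, and nonnegative off-diagonal entries. -/
open Matrix Pointwise

theorem stmt15 {n m : ℕ} (V : Matrix (Fin n) (Fin m) ℝ)
    (hV : (0 : Fin n → ℝ) ∈ interior (polyV V)) (A : Matrix (Fin n) (Fin n) ℝ)
    (ηs : ℝ) (Ms : Matrix (Fin m) (Fin m) ℝ)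
    (hrate : ∀ j, ∑ i, Ms i j = -ηs) (heq : A * V = V * Ms)
    (hmetzler : ∀ i j, i ≠ j → 0 ≤ Ms i j) :
    ∀ η : ℝ, η < ηs → ∃ M : Matrix (Fin m) (Fin m) ℝ,
      (∀ j, ∑ i, M i j = -η) ∧ A * V = V * M ∧ (∀ i j, i ≠ j → 0 ≤ M i j) := by
  intro η hη
  obtain ⟨p, hp, hsum, hzero⟩ := interior_subset hV
  refine ⟨Ms + (ηs - η) • vecMulVec p 1, fun j => ?_, ?_, fun i j hij => ?_⟩
  · simp only [Matrix.add_apply, Matrix.smul_apply, vecMulVec_apply, Pi.one_apply, mul_one, smul_eq_mul,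
      Finset.sum_add_distrib, hrate, ← Finset.mul_sum, hsum]
    ring
  · rw [Matrix.mul_add, Matrix.mul_smul, mul_vecMulVec, ← hzero, zero_vecMulVec, smul_zero,
      add_zero, heq]
  · simpa using
      add_nonneg (hmetzler i j hij) (mul_nonneg (sub_nonneg.mpr hη.le) (hp i))
end
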